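/- Let 𝕜 be a field and s ∈ 𝕜 with s ≠ 0 and s⁴ ≠ 1 (so that q = s² satisfies q ∉ {0, 1, −1}). Let U'_q(𝔰𝔬₃) be the quotient of the free 𝕜-algebra on generators I₁,I₂,I₃ by the two-sided ideal generated by the three elements I₂I₁ − s²I₁I₂ + sI₃, I₃I₁ − s⁻²I₁I₃ − s⁻¹I₂, and I₃I₂ − s²I₂I₃ + sI₁. Then the images of the monomials I₁^{a₁}I₂^{a₂}I₃^{a₃}, (a₁,a₂,a₃) ∈ ℕ³, form a basis of U'_q(𝔰𝔬₃) as a 𝕜-vector space. -/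

import Mathlib

noncomputable section

open FreeAlgebra

/-- The defining relations of `U'_q(𝔰𝔬₃)` with `q = s²`:
`I₂I₁ = s²I₁I₂ − sI₃`, `I₃I₁ = s⁻²I₁I₃ + s⁻¹I₂`, `I₃I₂ = s²I₂I₃ − sI₁`. -/
def SO3Rel (𝕜 : Type*) [Field 𝕜] (s : 𝕜) :
    FreeAlgebra 𝕜 (Fin 3) → FreeAlgebra 𝕜 (Fin 3) → Prop := fun u v =>
  (u = ι 𝕜 (1 : Fin 3) * ι 𝕜 (0 : Fin 3) ∧
    v = (s ^ 2) • (ι 𝕜 (0 : Fin 3) * ι 𝕜 (1 : Fin 3)) - s • ι 𝕜 (2 : Fin 3)) ∨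
  (u = ι 𝕜 (2 : Fin 3) * ι 𝕜 (0 : Fin 3) ∧
    v = (s ^ 2)⁻¹ • (ι 𝕜 (0 : Fin 3) * ι 𝕜 (2 : Fin 3)) + s⁻¹ • ι 𝕜 (1 : Fin 3)) ∨
  (u = ι 𝕜 (2 : Fin 3) * ι 𝕜 (1 : Fin 3) ∧
    v = (s ^ 2) • (ι 𝕜 (1 : Fin 3) * ι 𝕜 (2 : Fin 3)) - s • ι 𝕜 (0 : Fin 3))

/-- The algebra `U'_q(𝔰𝔬₃)`. -/
abbrev USO3 (𝕜 : Type*) [Field 𝕜] (s : 𝕜) : Type _ :=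
  RingQuot (SO3Rel 𝕜 s)

/-- The images of the generators `I₁, I₂, I₃`. -/
def Igen (𝕜 : Type*) [Field 𝕜] (s : 𝕜) (i : Fin 3) : USO3 𝕜 s :=
  RingQuot.mkAlgHom 𝕜 (SO3Rel 𝕜 s) (ι 𝕜 i)


section Span

variable {𝕜 : Type*} [Field 𝕜] {s : 𝕜}

theorem Igen_one_mul_zero :
    Igen 𝕜 s 1 * Igen 𝕜 s 0 = (s ^ 2) • (Igen 𝕜 s 0 * Igen 𝕜 s 1) - s • Igen 𝕜 s 2 := by
  simpa [Igen] using RingQuot.mkAlgHom_rel 𝕜 (s := SO3Rel 𝕜 s) (Or.inl ⟨rfl, rfl⟩)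

theorem Igen_two_mul_zero :
    Igen 𝕜 s 2 * Igen 𝕜 s 0 = (s ^ 2)⁻¹ • (Igen 𝕜 s 0 * Igen 𝕜 s 2) + s⁻¹ • Igen 𝕜 s 1 := by
  simpa [Igen] using RingQuot.mkAlgHom_rel 𝕜 (s := SO3Rel 𝕜 s) (Or.inr (Or.inl ⟨rfl, rfl⟩))

theorem Igen_two_mul_one :
    Igen 𝕜 s 2 * Igen 𝕜 s 1 = (s ^ 2) • (Igen 𝕜 s 1 * Igen 𝕜 s 2) - s • Igen 𝕜 s 0 := by
  simpa [Igen] using RingQuot.mkAlgHom_rel 𝕜 (s := SO3Rel 𝕜 s) (Or.inr (Or.inr ⟨rfl, rfl⟩))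

variable (𝕜 s) in
/-- The ordered monomial `I₁^a I₂^b I₃^c`. -/
def orderedMonomial (a b c : ℕ) : USO3 𝕜 s :=
  Igen 𝕜 s 0 ^ a * Igen 𝕜 s 1 ^ b * Igen 𝕜 s 2 ^ c

variable (𝕜 s) in
/-- The span of the ordered monomials of degree at most `n`. -/
def degreeLE (n : ℕ) : Submodule 𝕜 (USO3 𝕜 s) :=
  Submodule.span 𝕜 {u | ∃ a b c, a + b + c ≤ n ∧ orderedMonomial 𝕜 s a b c = u}

theorem orderedMonomial_mem_degreeLE {a b c n : ℕ} (h : a + b + c ≤ n) :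
    orderedMonomial 𝕜 s a b c ∈ degreeLE 𝕜 s n :=
  Submodule.subset_span ⟨a, b, c, h, rfl⟩

theorem degreeLE_mono {m n : ℕ} (h : m ≤ n) : degreeLE 𝕜 s m ≤ degreeLE 𝕜 s n :=
  Submodule.span_mono fun _ ⟨a, b, c, hm, hu⟩ => ⟨a, b, c, hm.trans h, hu⟩

theorem mul_mem_of_orderedMonomial {g : USO3 𝕜 s} {n : ℕ} {N : Submodule 𝕜 (USO3 𝕜 s)}
    (h : ∀ a b c, a + b + c ≤ n → g * orderedMonomial 𝕜 s a b c ∈ N)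
    {u : USO3 𝕜 s} (hu : u ∈ degreeLE 𝕜 s n) : g * u ∈ N := by
  have : degreeLE 𝕜 s n ≤ N.comap (LinearMap.mulLeft 𝕜 g) := by
    refine Submodule.span_le.2 ?_
    rintro _ ⟨a, b, c, hm, rfl⟩
    exact h a b c hm
  exact this hu

theorem Igen_zero_mul_orderedMonomial (a b c : ℕ) :
    Igen 𝕜 s 0 * orderedMonomial 𝕜 s a b c = orderedMonomial 𝕜 s (a + 1) b c := by
  simp only [orderedMonomial, pow_succ', mul_assoc]

theorem Igen_one_mul_orderedMonomial (b c : ℕ) :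
    Igen 𝕜 s 1 * orderedMonomial 𝕜 s 0 b c = orderedMonomial 𝕜 s 0 (b + 1) c := by
  simp only [orderedMonomial, pow_succ', pow_zero, one_mul, mul_assoc]

theorem Igen_two_mul_orderedMonomial (c : ℕ) :
    Igen 𝕜 s 2 * orderedMonomial 𝕜 s 0 0 c = orderedMonomial 𝕜 s 0 0 (c + 1) := by
  simp only [orderedMonomial, pow_succ', pow_zero, one_mul]

theorem Igen_zero_mul_mem {n : ℕ} {u : USO3 𝕜 s} (hu : u ∈ degreeLE 𝕜 s n) :
    Igen 𝕜 s 0 * u ∈ degreeLE 𝕜 s (n + 1) := by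
  refine mul_mem_of_orderedMonomial (fun a b c h => ?_) hu
  rw [Igen_zero_mul_orderedMonomial]
  exact orderedMonomial_mem_degreeLE (by omega)

theorem Igen_mul_mem_degreeLE (n : ℕ) :
    (∀ u ∈ degreeLE 𝕜 s n, Igen 𝕜 s 1 * u ∈ degreeLE 𝕜 s (n + 1)) ∧
      ∀ u ∈ degreeLE 𝕜 s n, Igen 𝕜 s 2 * u ∈ degreeLE 𝕜 s (n + 1) := by
  induction n with
  | zero =>
    constructor <;> intro u hu <;> refine mul_mem_of_orderedMonomial (fun a b c h => ?_) hu <;>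
      obtain ⟨rfl, rfl, rfl⟩ : a = 0 ∧ b = 0 ∧ c = 0 := by omega
    · rw [Igen_one_mul_orderedMonomial]
      exact orderedMonomial_mem_degreeLE (by omega)
    · rw [Igen_two_mul_orderedMonomial]
      exact orderedMonomial_mem_degreeLE (by omega)
  | succ n ih =>
    have hy : ∀ u ∈ degreeLE 𝕜 s (n + 1), Igen 𝕜 s 1 * u ∈ degreeLE 𝕜 s (n + 1 + 1) := by
      refine fun u hu => mul_mem_of_orderedMonomial (fun a b c h => ?_) hu
      cases a with
      | zero =>
        rw [Igen_one_mul_orderedMonomial]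
        exact orderedMonomial_mem_degreeLE (by omega)
      | succ a =>
        have hm : orderedMonomial 𝕜 s a b c ∈ degreeLE 𝕜 s n :=
          orderedMonomial_mem_degreeLE (by omega)
        rw [← Igen_zero_mul_orderedMonomial, ← mul_assoc, Igen_one_mul_zero, sub_mul,
          smul_mul_assoc, smul_mul_assoc, mul_assoc]
        exact sub_mem (Submodule.smul_mem _ _ (Igen_zero_mul_mem (ih.1 _ hm)))
          (Submodule.smul_mem _ _ (degreeLE_mono (Nat.le_succ _) (ih.2 _ hm)))
    refine ⟨hy, fun u hu => mul_mem_of_orderedMonomial (fun a b c h => ?_) hu⟩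
    cases a with
    | zero =>
      cases b with
      | zero =>
        rw [Igen_two_mul_orderedMonomial]
        exact orderedMonomial_mem_degreeLE (by omega)
      | succ b =>
        have hm : orderedMonomial 𝕜 s 0 b c ∈ degreeLE 𝕜 s n :=
          orderedMonomial_mem_degreeLE (by omega)
        rw [← Igen_one_mul_orderedMonomial, ← mul_assoc, Igen_two_mul_one, sub_mul,
          smul_mul_assoc, smul_mul_assoc, mul_assoc]
        exact sub_mem (Submodule.smul_mem _ _ (hy _ (ih.2 _ hm)))
          (Submodule.smul_mem _ _ (degreeLE_mono (Nat.le_succ _) (Igen_zero_mul_mem hm)))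
    | succ a =>
      have hm : orderedMonomial 𝕜 s a b c ∈ degreeLE 𝕜 s n :=
        orderedMonomial_mem_degreeLE (by omega)
      rw [← Igen_zero_mul_orderedMonomial, ← mul_assoc, Igen_two_mul_zero, add_mul,
        smul_mul_assoc, smul_mul_assoc, mul_assoc]
      exact add_mem (Submodule.smul_mem _ _ (Igen_zero_mul_mem (ih.2 _ hm)))
        (Submodule.smul_mem _ _ (degreeLE_mono (Nat.le_succ _) (ih.1 _ hm)))

theorem Igen_mul_mem {n : ℕ} (i : Fin 3) {u : USO3 𝕜 s} (hu : u ∈ degreeLE 𝕜 s n) :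
    Igen 𝕜 s i * u ∈ degreeLE 𝕜 s (n + 1) := by
  fin_cases i
  · exact Igen_zero_mul_mem hu
  · exact (Igen_mul_mem_degreeLE n).1 u hu
  · exact (Igen_mul_mem_degreeLE n).2 u hu

theorem exists_mem_degreeLE (u : USO3 𝕜 s) : ∃ n, u ∈ degreeLE 𝕜 s n := by
  obtain ⟨w, rfl⟩ := RingQuot.mkAlgHom_surjective 𝕜 (SO3Rel 𝕜 s) u
  suffices h : ∀ m (v : USO3 𝕜 s), v ∈ degreeLE 𝕜 s m →
      ∃ n, RingQuot.mkAlgHom 𝕜 (SO3Rel 𝕜 s) w * v ∈ degreeLE 𝕜 s n by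
    have h1 : (1 : USO3 𝕜 s) ∈ degreeLE 𝕜 s 0 := by
      simpa [orderedMonomial] using
        orderedMonomial_mem_degreeLE (𝕜 := 𝕜) (s := s) (a := 0) (b := 0) (c := 0) le_rfl
    simpa using h 0 1 h1
  induction w using FreeAlgebra.induction with
  | grade0 r =>
    intro m v hv
    refine ⟨m, ?_⟩
    rw [AlgHom.commutes, ← Algebra.smul_def]
    exact Submodule.smul_mem _ _ hv
  | grade1 i => exact fun m v hv => ⟨m + 1, Igen_mul_mem i hv⟩
  | mul x y hx hy =>
    intro m v hv
    obtain ⟨n, hn⟩ := hy m v hv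
    obtain ⟨k, hk⟩ := hx n _ hn
    exact ⟨k, by rwa [map_mul, mul_assoc]⟩
  | add x y hx hy =>
    intro m v hv
    obtain ⟨n, hn⟩ := hy m v hv
    obtain ⟨k, hk⟩ := hx m v hv
    refine ⟨max n k, ?_⟩
    rw [map_add, add_mul]
    exact add_mem (degreeLE_mono (le_max_right _ _) hk) (degreeLE_mono (le_max_left _ _) hn)

end Span

section QuantumTorus

variable {𝕜 : Type*} [Field 𝕜]

/-- The Weyl-ordered monomial with exponent `(a, b, c)` of the quantum torus of rank three,
acting on functions on the lattice `ℤ³`. -/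
def weyl (s : 𝕜) (a b c : ℤ) : Module.End 𝕜 (ℤ → ℤ → ℤ → 𝕜) where
  toFun f := fun x y z =>
    s ^ (b * x - a * y + (c * y - b * z) + (a * z - c * x)) * f (x - a) (y - b) (z - c)
  map_add' f g := by
    ext x y z
    simp [mul_add]
  map_smul' r f := by
    ext x y z
    simp [mul_left_comm]

theorem weyl_apply (s : 𝕜) (a b c : ℤ) (f : ℤ → ℤ → ℤ → 𝕜) (x y z : ℤ) :
    weyl s a b c f x y z =
      s ^ (b * x - a * y + (c * y - b * z) + (a * z - c * x)) * f (x - a) (y - b) (z - c) :=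
  rfl

theorem weyl_mul {s : 𝕜} (hs : s ≠ 0) (a b c a' b' c' : ℤ) :
    weyl s a b c * weyl s a' b' c' =
      s ^ (b * a' - a * b' + (c * b' - b * c') + (a * c' - c * a')) •
        weyl s (a + a') (b + b') (c + c') := by
  ext f x y z
  simp only [Module.End.mul_apply, LinearMap.smul_apply, Pi.smul_apply, smul_eq_mul, weyl_apply,
    ← mul_assoc, ← zpow_add₀ hs, sub_sub]
  congr 2
  ring

/-- The quantum trace of the first generator, up to normalization. -/
def traceX (s : 𝕜) : Module.End 𝕜 (ℤ → ℤ → ℤ → 𝕜) :=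
  weyl s 1 1 0 + weyl s 1 (-1) 0 + weyl s (-1) (-1) 0

/-- The quantum trace of the second generator, up to normalization. -/
def traceY (s : 𝕜) : Module.End 𝕜 (ℤ → ℤ → ℤ → 𝕜) :=
  weyl s 0 1 1 + weyl s 0 1 (-1) + weyl s 0 (-1) (-1)

/-- The quantum trace of the third generator, up to normalization. -/
def traceZ (s : 𝕜) : Module.End 𝕜 (ℤ → ℤ → ℤ → 𝕜) :=
  weyl s 1 0 1 + weyl s (-1) 0 1 + weyl s (-1) 0 (-1)

theorem traceY_mul_traceX {s : 𝕜} (hs : s ≠ 0) :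
    traceY s * traceX s =
      s ^ 2 • (traceX s * traceY s) - (s * (s ^ 2 - (s ^ 2)⁻¹)) • traceZ s := by
  simp only [traceX, traceY, traceZ, mul_add, add_mul, weyl_mul hs]
  norm_num [zpow_neg, zpow_ofNat]
  match_scalars <;> field_simp <;> ring

theorem traceZ_mul_traceX {s : 𝕜} (hs : s ≠ 0) :
    traceZ s * traceX s =
      (s ^ 2)⁻¹ • (traceX s * traceZ s) + (s⁻¹ * (s ^ 2 - (s ^ 2)⁻¹)) • traceY s := by
  simp only [traceX, traceY, traceZ, mul_add, add_mul, weyl_mul hs]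
  norm_num [zpow_neg, zpow_ofNat]
  match_scalars <;> field_simp <;> ring

theorem traceZ_mul_traceY {s : 𝕜} (hs : s ≠ 0) :
    traceZ s * traceY s =
      s ^ 2 • (traceY s * traceZ s) - (s * (s ^ 2 - (s ^ 2)⁻¹)) • traceX s := by
  simp only [traceX, traceY, traceZ, mul_add, add_mul, weyl_mul hs]
  norm_num [zpow_neg, zpow_ofNat]
  match_scalars <;> field_simp <;> ring

/-- The generators' images in the quantum torus. -/
def traceGen (s : 𝕜) (i : Fin 3) : Module.End 𝕜 (ℤ → ℤ → ℤ → 𝕜) :=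
  (s ^ 2 - (s ^ 2)⁻¹)⁻¹ • ![traceX s, traceY s, traceZ s] i

theorem sq_sub_inv_sq_ne_zero {s : 𝕜} (hs : s ≠ 0) (hs4 : s ^ 4 ≠ 1) :
    s ^ 2 - (s ^ 2)⁻¹ ≠ 0 := by
  intro h
  apply hs4
  field_simp at h
  linear_combination h

/-- The quantum trace representation of `U'_q(𝔰𝔬₃)`. -/
def quantumTrace {s : 𝕜} (hs : s ≠ 0) (hs4 : s ^ 4 ≠ 1) :
    USO3 𝕜 s →ₐ[𝕜] Module.End 𝕜 (ℤ → ℤ → ℤ → 𝕜) :=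
  RingQuot.liftAlgHom 𝕜 ⟨FreeAlgebra.lift 𝕜 (traceGen s), by
    have hκ := sq_sub_inv_sq_ne_zero hs hs4
    rintro u v (⟨rfl, rfl⟩ | ⟨rfl, rfl⟩ | ⟨rfl, rfl⟩) <;>
      simp only [map_mul, map_sub, map_add, map_smul, FreeAlgebra.lift_ι_apply, traceGen,
        Matrix.cons_val, smul_mul_smul_comm, traceY_mul_traceX hs, traceZ_mul_traceX hs,
        traceZ_mul_traceY hs] <;>
      generalize s ^ 2 - (s ^ 2)⁻¹ = κ at hκ ⊢ <;>
      match_scalars <;> field_simp⟩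

theorem quantumTrace_Igen {s : 𝕜} (hs : s ≠ 0) (hs4 : s ^ 4 ≠ 1) (i : Fin 3) :
    quantumTrace hs hs4 (Igen 𝕜 s i) = traceGen s i := by
  simp [quantumTrace, Igen]

/-- `f` is nonzero at `(p, q, r)`, and its support lies otherwise in strictly smaller total
degree. -/
def HasLeadingExponent (f : ℤ → ℤ → ℤ → 𝕜) (p q r : ℤ) : Prop :=
  f p q r ≠ 0 ∧ ∀ x y z, f x y z ≠ 0 → (x = p ∧ y = q ∧ z = r) ∨ x + y + z < p + q + r

theorem HasLeadingExponent.eq_zero {f : ℤ → ℤ → ℤ → 𝕜} {p q r x y z : ℤ}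
    (h : HasLeadingExponent f p q r) (hne : ¬(x = p ∧ y = q ∧ z = r))
    (hle : p + q + r ≤ x + y + z) : f x y z = 0 := by
  by_contra hf
  rcases h.2 x y z hf with h | h
  · exact hne h
  · omega

theorem HasLeadingExponent.smul {f : ℤ → ℤ → ℤ → 𝕜} {p q r : ℤ}
    (h : HasLeadingExponent f p q r) {k : 𝕜} (hk : k ≠ 0) : HasLeadingExponent (k • f) p q r :=
  ⟨by simpa [hk] using h.1, fun x y z hf => h.2 x y z (right_ne_zero_of_mul hf)⟩

theorem HasLeadingExponent.weyl {s : 𝕜} (hs : s ≠ 0) {f : ℤ → ℤ → ℤ → 𝕜} {p q r : ℤ}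
    (h : HasLeadingExponent f p q r) (a b c : ℤ) :
    HasLeadingExponent (weyl s a b c f) (p + a) (q + b) (r + c) := by
  refine ⟨?_, fun x y z hf => ?_⟩
  · simpa [weyl_apply, zpow_ne_zero _ hs] using h.1
  · rcases h.2 _ _ _ (right_ne_zero_of_mul hf) with h | h <;> omega

theorem HasLeadingExponent.add {f g : ℤ → ℤ → ℤ → 𝕜} {p q r p' q' r' : ℤ}
    (hf : HasLeadingExponent f p q r) (hg : HasLeadingExponent g p' q' r')
    (hlt : p' + q' + r' < p + q + r) : HasLeadingExponent (f + g) p q r := by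
  refine ⟨?_, fun x y z h => ?_⟩
  · simpa [hg.eq_zero (x := p) (y := q) (z := r) (by omega) (by omega)] using hf.1
  · by_cases hx : f x y z = 0
    · have hx' : g x y z ≠ 0 := by simpa [hx] using h
      rcases hg.2 x y z hx' with h | h <;> omega
    · exact hf.2 x y z hx

theorem HasLeadingExponent.traceGen_zero {s : 𝕜} (hs : s ≠ 0) (hs4 : s ^ 4 ≠ 1)
    {f : ℤ → ℤ → ℤ → 𝕜} {p q r : ℤ} (h : HasLeadingExponent f p q r) (n : ℕ) :
    HasLeadingExponent ((traceGen s 0 ^ n) f) (p + n) (q + n) r := by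
  induction n with
  | zero => simpa using h
  | succ n ih =>
    have := ((((ih.weyl hs 1 1 0).add (ih.weyl hs 1 (-1) 0) (by omega)).add
      (ih.weyl hs (-1) (-1) 0) (by omega)).smul (inv_ne_zero (sq_sub_inv_sq_ne_zero hs hs4)))
    rw [pow_succ', Module.End.mul_apply]
    simp only [add_zero, add_assoc _ (n : ℤ)] at this
    exact_mod_cast this

theorem HasLeadingExponent.traceGen_one {s : 𝕜} (hs : s ≠ 0) (hs4 : s ^ 4 ≠ 1)
    {f : ℤ → ℤ → ℤ → 𝕜} {p q r : ℤ} (h : HasLeadingExponent f p q r) (n : ℕ) :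
    HasLeadingExponent ((traceGen s 1 ^ n) f) p (q + n) (r + n) := by
  induction n with
  | zero => simpa using h
  | succ n ih =>
    have := ((((ih.weyl hs 0 1 1).add (ih.weyl hs 0 1 (-1)) (by omega)).add
      (ih.weyl hs 0 (-1) (-1)) (by omega)).smul (inv_ne_zero (sq_sub_inv_sq_ne_zero hs hs4)))
    rw [pow_succ', Module.End.mul_apply]
    simp only [add_zero, add_assoc _ (n : ℤ)] at this
    exact_mod_cast this

theorem HasLeadingExponent.traceGen_two {s : 𝕜} (hs : s ≠ 0) (hs4 : s ^ 4 ≠ 1)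
    {f : ℤ → ℤ → ℤ → 𝕜} {p q r : ℤ} (h : HasLeadingExponent f p q r) (n : ℕ) :
    HasLeadingExponent ((traceGen s 2 ^ n) f) (p + n) q (r + n) := by
  induction n with
  | zero => simpa using h
  | succ n ih =>
    have := ((((ih.weyl hs 1 0 1).add (ih.weyl hs (-1) 0 1) (by omega)).add
      (ih.weyl hs (-1) 0 (-1)) (by omega)).smul (inv_ne_zero (sq_sub_inv_sq_ne_zero hs hs4)))
    rw [pow_succ', Module.End.mul_apply]
    simp only [add_zero, add_assoc _ (n : ℤ)] at this
    exact_mod_cast this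

theorem hasLeadingExponent_quantumTrace {s : 𝕜} (hs : s ≠ 0) (hs4 : s ^ 4 ≠ 1) (a b c : ℕ) :
    HasLeadingExponent
      (quantumTrace hs hs4 (Igen 𝕜 s 0 ^ a * Igen 𝕜 s 1 ^ b * Igen 𝕜 s 2 ^ c)
        fun x y z => if x = 0 ∧ y = 0 ∧ z = 0 then 1 else 0) (c + a) (b + a) (c + b) := by
  have h0 : HasLeadingExponent
      (fun x y z : ℤ => if x = 0 ∧ y = 0 ∧ z = 0 then (1 : 𝕜) else 0) 0 0 0 :=
    ⟨by simp, fun x y z h => Or.inl (by simpa using h)⟩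
  have := ((h0.traceGen_two hs hs4 c).traceGen_one hs hs4 b).traceGen_zero hs hs4 a
  simpa [quantumTrace_Igen] using this

theorem linearIndependent_of_hasLeadingExponent {f : ℕ × ℕ × ℕ → ℤ → ℤ → ℤ → 𝕜}
    (hf : ∀ m, HasLeadingExponent (f m) (m.2.2 + m.1) (m.2.1 + m.1) (m.2.2 + m.2.1)) :
    LinearIndependent 𝕜 f := by
  classical
  rw [linearIndependent_iff']
  intro t k hsum
  by_contra! hne
  obtain ⟨i, hi, hki⟩ := hne
  obtain ⟨m, hm, hmax⟩ := (t.filter (k · ≠ 0)).exists_max_image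
    (fun m => m.1 + m.2.1 + m.2.2) ⟨i, by simp [hi, hki]⟩
  rw [Finset.mem_filter] at hm
  have h := congrFun (congrFun (congrFun hsum (m.2.2 + m.1)) (m.2.1 + m.1)) (m.2.2 + m.2.1)
  simp only [Finset.sum_apply, Pi.smul_apply, smul_eq_mul, Pi.zero_apply] at h
  rw [Finset.sum_eq_single_of_mem m hm.1] at h
  · exact mul_ne_zero hm.2 (hf m).1 h
  · intro j hj hjm
    by_cases hk : k j = 0
    · simp [hk]
    · have hle := hmax j (by simp [hj, hk])
      rw [(hf j).eq_zero _ (by omega), mul_zero]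
      contrapose! hjm
      ext <;> omega

end QuantumTorus

/-- The monomials `I₁^{a₁} I₂^{a₂} I₃^{a₃}` form a basis of `U'_q(𝔰𝔬₃)`. -/
theorem uso3_pbw (𝕜 : Type*) [Field 𝕜] (s : 𝕜) (hs : s ≠ 0) (hs4 : s ^ 4 ≠ 1) :
    LinearIndependent 𝕜 (fun m : ℕ × ℕ × ℕ =>
      Igen 𝕜 s 0 ^ m.1 * Igen 𝕜 s 1 ^ m.2.1 * Igen 𝕜 s 2 ^ m.2.2) ∧
    Submodule.span 𝕜 (Set.range (fun m : ℕ × ℕ × ℕ =>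
      Igen 𝕜 s 0 ^ m.1 * Igen 𝕜 s 1 ^ m.2.1 * Igen 𝕜 s 2 ^ m.2.2)) = ⊤ := by
  constructor
  · refine LinearIndependent.of_comp ((LinearMap.applyₗ (R := 𝕜) (M₂ := ℤ → ℤ → ℤ → 𝕜)
      fun x y z => if x = 0 ∧ y = 0 ∧ z = 0 then 1 else 0) ∘ₗ
        (quantumTrace hs hs4).toLinearMap) ?_
    exact linearIndependent_of_hasLeadingExponent
      fun m => hasLeadingExponent_quantumTrace hs hs4 m.1 m.2.1 m.2.2
  · refine eq_top_iff.2 fun u _ => ?_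
    obtain ⟨n, hn⟩ := exists_mem_degreeLE u
    refine Submodule.span_mono ?_ hn
    rintro _ ⟨a, b, c, -, rfl⟩
    exact ⟨(a, b, c), rfl⟩
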